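/- arXiv:0808.2366 — 6 statements merged into one kernel-verified Lean document; each statement's English description precedes it below -/
import Mathlib

section
/- For every open set U ⊆ X, the set {t ∈ [0,T] : A(t) ∩ U ≠ ∅} is Lebesgue measurable. -/
open Filter Topology MeasureTheory

/-- A sequence in a compact metric space has a cluster point in the open set `U`, along indices for
which `a` tends to `b`, iff it visits, infinitely often with `a` close to `b`, some element of the
countable basis whose closure lies in `U`. -/
theorem exists_subseq_tendsto_mem_open_iff {X : Type*} [MetricSpace X] [CompactSpace X]
    (u : ℕ → X) (a : ℕ → ℝ) (b : ℝ) {U : Set X} (hU : IsOpen U) :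
    ({x : X | ∃ k : ℕ → ℕ, Tendsto k atTop atTop ∧ Tendsto (fun j => u (k j)) atTop (𝓝 x) ∧
      Tendsto (fun j => a (k j)) atTop (𝓝 b)} ∩ U).Nonempty ↔
    ∃ V ∈ {V ∈ TopologicalSpace.countableBasis X | closure V ⊆ U},
      ∀ m : ℕ, ∃ k ∈ Set.Ici m, u k ∈ V ∧ dist (a k) b < 1 / ((m : ℝ) + 1) := by
  constructor
  · rintro ⟨x, ⟨k, hk, hu, ha⟩, hxU⟩
    have hB := TopologicalSpace.isBasis_countableBasis X
    obtain ⟨V, hV, hxV, hVU⟩ := hB.exists_closure_subset (hU.mem_nhds hxU)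
    refine ⟨V, ⟨hV, hVU⟩, fun m => ?_⟩
    have hVx : V ∈ 𝓝 x := (hB.isOpen hV).mem_nhds hxV
    obtain ⟨j, hj, hjV, hja⟩ := ((hk.eventually_ge_atTop m).and ((hu.eventually hVx).and
      (Metric.tendsto_nhds.1 ha _ (Nat.one_div_pos_of_nat (n := m))))).exists
    exact ⟨k j, hj, hjV, hja⟩
  · rintro ⟨V, ⟨-, hVU⟩, h⟩
    choose k hk hkV hka using h
    obtain ⟨x, hx, φ, hφ, hlim⟩ :=
      isClosed_closure.isCompact.tendsto_subseq fun m => subset_closure (hkV m)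
    have hk' : Tendsto k atTop atTop := tendsto_atTop_mono hk tendsto_id
    have ha : Tendsto (fun m => a (k m)) atTop (𝓝 b) :=
      tendsto_iff_dist_tendsto_zero.2 <| squeeze_zero (fun _ => dist_nonneg)
        (fun m => (hka m).le) tendsto_one_div_add_atTop_nhds_zero_nat
    exact ⟨x, ⟨k ∘ φ, hk'.comp hφ.tendsto_atTop, hlim, ha.comp hφ.tendsto_atTop⟩, hVU hx⟩

/-- With `f k` Borel measurable on `[0,T]` and `θk k, θ`
Lebesgue measurable on `[0,T]`, for every open set `U ⊆ X` the set
`{t ∈ [0,T] : A t ∩ U ≠ ∅}` is Lebesgue measurable. -/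
theorem stmt1 {X : Type*} [MetricSpace X] [CompactSpace X]
    [MeasurableSpace X] [BorelSpace X]
    (T : ℝ) (hT : 0 < T)
    (f : ℕ → ℝ → X) (θk : ℕ → ℝ → ℝ) (θ : ℝ → ℝ)
    (hf : ∀ k, Measurable fun t : Set.Icc (0:ℝ) T => f k t)
    (hθk : ∀ k, NullMeasurable (θk k) (volume.restrict (Set.Icc (0:ℝ) T)))
    (hθ : NullMeasurable θ (volume.restrict (Set.Icc (0:ℝ) T)))
    (A : ℝ → Set X)
    (hA : ∀ t, A t = {x : X | ∃ k : ℕ → ℕ, Tendsto k atTop atTop ∧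
      Tendsto (fun j => f (k j) t) atTop (𝓝 x) ∧
      Tendsto (fun j => θk (k j) t) atTop (𝓝 (θ t))})
    (U : Set X) (hU : IsOpen U) :
    NullMeasurableSet {t ∈ Set.Icc (0:ℝ) T | (A t ∩ U).Nonempty} volume := by
  have hset : {t ∈ Set.Icc (0:ℝ) T | (A t ∩ U).Nonempty} =
      (⋃ V ∈ {V ∈ TopologicalSpace.countableBasis X | closure V ⊆ U}, ⋂ m : ℕ, ⋃ k ∈ Set.Ici m,
        (f k ⁻¹' V ∩ {t | dist (θk k t) (θ t) < 1 / ((m : ℝ) + 1)})) ∩ Set.Icc (0:ℝ) T := by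
    ext t
    have h := exists_subseq_tendsto_mem_open_iff (fun k => f k t) (fun k => θk k t) (θ t) hU
    rw [← hA] at h
    rw [Set.mem_ofPred_eq, h, and_comm]
    simp only [Set.mem_inter_iff, Set.mem_iUnion, Set.mem_iInter, Set.mem_preimage,
      Set.mem_ofPred_eq, exists_prop]
  have hI : MeasurableSet (Set.Icc (0:ℝ) T) := measurableSet_Icc
  rw [hset, ← nullMeasurableSet_restrict hI.nullMeasurableSet]
  refine .biUnion ((TopologicalSpace.countable_countableBasis X).mono (Set.sep_subset _ _))
    fun V hV => .iInter fun m => .biUnion (Set.to_countable _) fun k _ => .inter ?_ ?_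
  · rw [nullMeasurableSet_restrict hI.nullMeasurableSet, Set.inter_comm,
      ← Subtype.image_preimage_coe]
    have hVo : IsOpen V := (TopologicalSpace.isBasis_countableBasis X).isOpen hV.1
    exact (hI.subtype_image (hf k hVo.measurableSet)).nullMeasurableSet
  · exact nullMeasurableSet_lt ((hθk k).aemeasurable.dist hθ.aemeasurable) aemeasurable_const
end

section
/- If in addition A(t) is nonempty for every t ∈ [0,T], then there exists a Lebesgue measurable function v : [0,T] → X such that v(t) ∈ A(t) for every t ∈ [0,T]. -/
open Filter Topology MeasureTheory

/-- **Kuratowski–Ryll-Nardzewski selection theorem**: a closed nonempty set-valued map into a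
complete separable metric space has a measurable selection as soon as the distance from each point
to its values is measurable. -/
theorem exists_measurable_selection_of_measurable_infDist {α X : Type*} [MeasurableSpace α]
    [MetricSpace X] [CompleteSpace X] [TopologicalSpace.SeparableSpace X] [Nonempty X]
    [MeasurableSpace X] [BorelSpace X] {A : α → Set X} (hc : ∀ t, IsClosed (A t))
    (hne : ∀ t, (A t).Nonempty) (hm : ∀ x, Measurable fun t => Metric.infDist x (A t)) :
    ∃ v : α → X, Measurable v ∧ ∀ t, v t ∈ A t := by
  classical
  have : SecondCountableTopology X := UniformSpace.secondCountable_of_separable X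
  let x : ℕ → X := TopologicalSpace.denseSeq X
  have hx (y : X) {r : ℝ} (hr : 0 < r) : ∃ i, dist y (x i) < r :=
    (TopologicalSpace.denseRange_denseSeq X).exists_dist_lt y hr
  let S (n : ℕ) : Type _ :=
    {u : α → X // Measurable u ∧ ∀ t, Metric.infDist (u t) (A t) < (1 / 2) ^ n}
  have hpos (n : ℕ) : (0 : ℝ) < (1 / 2) ^ n := by positivity
  have base : Nonempty (S 0) := by
    have h (t : α) : ∃ i, Metric.infDist (x i) (A t) < (1 / 2) ^ 0 := by
      obtain ⟨a, ha⟩ := hne t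
      obtain ⟨i, hi⟩ := hx a (hpos 0)
      exact ⟨i, (Metric.infDist_le_dist_of_mem ha).trans_lt (by rwa [dist_comm])⟩
    refine ⟨fun t => x (Nat.find (h t)), ?_, fun t => Nat.find_spec (h t)⟩
    exact (measurable_from_nat (f := x)).comp
      (measurable_find h fun i => measurableSet_lt (hm (x i)) measurable_const)
  have step (n : ℕ) (u : S n) :
      ∃ w : S (n + 1), ∀ t, dist (u.1 t) (w.1 t) < 2 * (1 / 2) ^ n := by
    have h (t : α) : ∃ i, Metric.infDist (x i) (A t) < (1 / 2) ^ (n + 1) ∧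
        dist (u.1 t) (x i) < 2 * (1 / 2) ^ n := by
      obtain ⟨a, ha, hua⟩ := (Metric.infDist_lt_iff (hne t)).1 (u.2.2 t)
      obtain ⟨i, hi⟩ := hx a (hpos (n + 1))
      refine ⟨i, (Metric.infDist_le_dist_of_mem ha).trans_lt (by rwa [dist_comm]), ?_⟩
      have h₁ := dist_triangle (u.1 t) a (x i)
      have h₂ := hpos n
      rw [pow_succ] at hi
      linarith
    refine ⟨⟨fun t => x (Nat.find (h t)), ?_, fun t => (Nat.find_spec (h t)).1⟩,
      fun t => (Nat.find_spec (h t)).2⟩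
    exact (measurable_from_nat (f := x)).comp (measurable_find h fun i =>
      (measurableSet_lt (hm (x i)) measurable_const).inter
        (measurableSet_lt (u.2.1.dist measurable_const) measurable_const))
  choose next hnext using step
  let u : (n : ℕ) → S n := fun n => Nat.rec base.some next n
  have hu (n : ℕ) (t : α) : dist ((u n).1 t) ((u (n + 1)).1 t) ≤ 2 * (1 / 2) ^ n :=
    (hnext n (u n) t).le
  have hlim (t : α) : ∃ y, Tendsto (fun n => (u n).1 t) atTop (𝓝 y) :=
    cauchySeq_tendsto_of_complete
      (cauchySeq_of_le_geometric (1 / 2) 2 (by norm_num) fun n => hu n t)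
  choose v hv using hlim
  refine ⟨v, measurable_of_tendsto_metrizable (fun n => (u n).2.1) (tendsto_pi_nhds.2 hv),
    fun t => ?_⟩
  rw [(hc t).mem_iff_infDist_zero (hne t)]
  refine tendsto_nhds_unique
    (((Metric.continuous_infDist_pt (A t)).tendsto (v t)).comp (hv t)) ?_
  exact squeeze_zero (fun _ => Metric.infDist_nonneg) (fun n => ((u n).2.2 t).le)
    (tendsto_pow_atTop_nhds_zero_of_lt_one (by norm_num) (by norm_num))

/-- The limits of the subsequences of `y` along which `c` tends to `l`. -/
def subseqLimits {X : Type*} [TopologicalSpace X] (y : ℕ → X) (c : ℕ → ℝ) (l : ℝ) : Set X :=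
  {x : X | ∃ k : ℕ → ℕ, Tendsto k atTop atTop ∧
    Tendsto (fun j => y (k j)) atTop (𝓝 x) ∧ Tendsto (fun j => c (k j)) atTop (𝓝 l)}

theorem mem_subseqLimits_iff {X : Type*} [MetricSpace X] {y : ℕ → X} {c : ℕ → ℝ} {l : ℝ} {x : X} :
    x ∈ subseqLimits y c l ↔
      ∀ ε > 0, ∃ᶠ k in atTop, dist (y k) x < ε ∧ dist (c k) l < ε := by
  constructor
  · rintro ⟨k, hk, hy, hc⟩ ε hε
    exact hk.frequently (((Metric.tendsto_nhds.1 hy ε hε).and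
      (Metric.tendsto_nhds.1 hc ε hε)).frequently)
  · intro h
    obtain ⟨k, hk, hd⟩ := extraction_forall_of_frequently
      fun n : ℕ => h (1 / ((n : ℝ) + 1)) Nat.one_div_pos_of_nat
    refine ⟨k, hk.tendsto_atTop, ?_, ?_⟩
    · exact tendsto_iff_dist_tendsto_zero.2 (squeeze_zero (fun _ => dist_nonneg)
        (fun n => (hd n).1.le) tendsto_one_div_add_atTop_nhds_zero_nat)
    · exact tendsto_iff_dist_tendsto_zero.2 (squeeze_zero (fun _ => dist_nonneg)
        (fun n => (hd n).2.le) tendsto_one_div_add_atTop_nhds_zero_nat)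

theorem isClosed_subseqLimits {X : Type*} [MetricSpace X] (y : ℕ → X) (c : ℕ → ℝ) (l : ℝ) :
    IsClosed (subseqLimits y c l) := by
  refine isClosed_of_closure_subset fun x hx => mem_subseqLimits_iff.2 fun ε hε => ?_
  obtain ⟨a, ha, hxa⟩ := Metric.mem_closure_iff.1 hx (ε / 2) (half_pos hε)
  refine (mem_subseqLimits_iff.1 ha (ε / 2) (half_pos hε)).mono fun k hk => ⟨?_, by linarith [hk.2]⟩
  linarith [dist_triangle_right (y k) x a, hk.1]

theorem infDist_subseqLimits_lt_iff {X : Type*} [MetricSpace X] [CompactSpace X] {y : ℕ → X}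
    {c : ℕ → ℝ} {l : ℝ} (hne : (subseqLimits y c l).Nonempty) {x : X} {r : ℝ} :
    Metric.infDist x (subseqLimits y c l) < r ↔
      ∃ q : ℚ, (q : ℝ) < r ∧ ∀ n : ℕ, ∃ᶠ k in atTop,
        dist x (y k) ≤ q ∧ dist (c k) l < 1 / ((n : ℝ) + 1) := by
  rw [Metric.infDist_lt_iff hne]
  constructor
  · rintro ⟨a, ⟨k, hk, hy, hc⟩, ha⟩
    obtain ⟨q, haq, hqr⟩ := exists_rat_btwn ha
    refine ⟨q, hqr, fun n => hk.frequently (Eventually.frequently ?_)⟩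
    filter_upwards [(tendsto_const_nhds.dist hy).eventually_lt_const haq,
      Metric.tendsto_nhds.1 hc _ Nat.one_div_pos_of_nat] with j h₁ h₂ using ⟨h₁.le, h₂⟩
  · rintro ⟨q, hqr, h⟩
    obtain ⟨k, hk, hd⟩ := extraction_forall_of_frequently h
    obtain ⟨a, φ, hφ, ha⟩ := CompactSpace.tendsto_subseq fun n => y (k n)
    have hc : Tendsto (fun n => c (k n)) atTop (𝓝 l) :=
      tendsto_iff_dist_tendsto_zero.2 (squeeze_zero (fun _ => dist_nonneg)
        (fun n => (hd n).2.le) tendsto_one_div_add_atTop_nhds_zero_nat)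
    refine ⟨a, ⟨k ∘ φ, (hk.comp hφ).tendsto_atTop, ha, hc.comp hφ.tendsto_atTop⟩, ?_⟩
    exact (le_of_tendsto (tendsto_const_nhds.dist ha)
      (Eventually.of_forall fun n => (hd (φ n)).1)).trans_lt hqr

theorem measurable_infDist_subseqLimits {α X : Type*} [MeasurableSpace α] [MetricSpace X]
    [CompactSpace X] [MeasurableSpace X] [BorelSpace X] {y : ℕ → α → X} {c : ℕ → α → ℝ} {l : α → ℝ}
    (hy : ∀ k, Measurable (y k)) (hc : ∀ k, Measurable (c k)) (hl : Measurable l)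
    (hne : ∀ t, (subseqLimits (y · t) (c · t) (l t)).Nonempty) (x : X) :
    Measurable fun t => Metric.infDist x (subseqLimits (y · t) (c · t) (l t)) := by
  refine measurable_of_Iio fun r => ?_
  simp only [Set.preimage, Set.mem_Iio, infDist_subseqLimits_lt_iff (hne _), frequently_atTop]
  refine measurableSet_setOfPred.2 (Measurable.exists fun q => ?_)
  refine (measurable_const (a := (q : ℝ) < r)).and (Measurable.forall fun n =>
    Measurable.forall fun m => Measurable.exists fun k =>
      (measurable_const (a := k ≥ m)).and (Measurable.and ?_ ?_))
  · exact measurableSet_setOfPred.1 (measurableSet_le (measurable_const.dist (hy k)) measurable_const)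
  · exact measurableSet_setOfPred.1 (measurableSet_lt ((hc k).dist hl) measurable_const)

/-- A measurable selection of the limits of subsequences over a measurable set, extended to the
whole space. -/
theorem exists_measurable_selection_subseqLimits {α X : Type*} [MeasurableSpace α] [MetricSpace X]
    [CompactSpace X] [Nonempty X] [MeasurableSpace X] [BorelSpace X] {s : Set α}
    (hs : MeasurableSet s) {y : ℕ → α → X} {c : ℕ → α → ℝ} {l : α → ℝ}
    (hy : ∀ k, Measurable fun t : s => y k t) (hc : ∀ k, Measurable (c k)) (hl : Measurable l)
    (hne : ∀ t ∈ s, (subseqLimits (y · t) (c · t) (l t)).Nonempty) :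
    ∃ v : α → X, Measurable v ∧ ∀ t ∈ s, v t ∈ subseqLimits (y · t) (c · t) (l t) := by
  obtain ⟨w, hw, hwA⟩ := exists_measurable_selection_of_measurable_infDist
    (fun t : s => isClosed_subseqLimits (y · t) (c · t) (l t)) (fun t => hne t t.2)
    (measurable_infDist_subseqLimits hy (fun k => (hc k).comp measurable_subtype_coe)
      (hl.comp measurable_subtype_coe) fun t => hne t t.2)
  obtain ⟨v, hv, hvw⟩ := (MeasurableEmbedding.subtype_coe hs).exists_measurable_extend hw
    fun _ => inferInstance
  refine ⟨v, hv, fun t ht => ?_⟩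
  have h := hwA ⟨t, ht⟩
  rwa [← hvw] at h

/-- If in addition `A t` is nonempty for every `t ∈ [0,T]`,
then there is a Lebesgue measurable selection `v : [0,T] → X` with
`v t ∈ A t` for every `t ∈ [0,T]`. -/
theorem stmt2 {X : Type*} [MetricSpace X] [CompactSpace X]
    [MeasurableSpace X] [BorelSpace X]
    (T : ℝ) (hT : 0 < T)
    (f : ℕ → ℝ → X) (θk : ℕ → ℝ → ℝ) (θ : ℝ → ℝ)
    (hf : ∀ k, Measurable fun t : Set.Icc (0:ℝ) T => f k t)
    (hθk : ∀ k, NullMeasurable (θk k) (volume.restrict (Set.Icc (0:ℝ) T)))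
    (hθ : NullMeasurable θ (volume.restrict (Set.Icc (0:ℝ) T)))
    (A : ℝ → Set X)
    (hA : ∀ t, A t = {x : X | ∃ k : ℕ → ℕ, Tendsto k atTop atTop ∧
      Tendsto (fun j => f (k j) t) atTop (𝓝 x) ∧
      Tendsto (fun j => θk (k j) t) atTop (𝓝 (θ t))})
    (hne : ∀ t ∈ Set.Icc (0:ℝ) T, (A t).Nonempty) :
    ∃ v : ℝ → X, NullMeasurable v (volume.restrict (Set.Icc (0:ℝ) T)) ∧
      ∀ t ∈ Set.Icc (0:ℝ) T, v t ∈ A t := by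
  have hs : MeasurableSet (Set.Icc (0:ℝ) T) := measurableSet_Icc
  have : Nonempty X := ⟨(hne 0 ⟨le_rfl, hT.le⟩).some⟩
  obtain rfl : A = fun t => subseqLimits (f · t) (θk · t) (θ t) := funext hA
  refine exists_measurable_selection_subseqLimits
    (α := NullMeasurableSpace ℝ (volume.restrict (Set.Icc (0:ℝ) T)))
    hs.nullMeasurableSet (fun k => ?_) hθk hθ hne
  exact (hf k).mono (MeasurableSpace.comap_mono fun _ h => h.nullMeasurableSet) le_rfl
end

section
/- For every t ∈ [0,T] and every x ∈ X, the infimal extended distance from x to A(t) equals the supremum over j ≥ 1 of the infimal extended distance from x to A_j(t); that is, infEdist(x, A(t)) = sup_{j ≥ 1} infEdist(x, A_j(t)) in [0, +∞], where the infimal extended distance to the empty set is +∞. -/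
open Filter Topology EMetric

/-- For every `t ∈ [0,T]` and `x ∈ X`,
`infEdist x (A t) = ⨆_{j ≥ 1} infEdist x (Aj j t)` in `[0,+∞]`
(with `infEdist x ∅ = +∞`). -/
theorem stmt4 {X : Type*} [MetricSpace X] [CompactSpace X]
    (T : ℝ) (hT : 0 < T)
    (f : ℕ → ℝ → X) (θk : ℕ → ℝ → ℝ) (θ : ℝ → ℝ)
    (A : ℝ → Set X)
    (hA : ∀ t, A t = {x : X | ∃ k : ℕ → ℕ, Tendsto k atTop atTop ∧
      Tendsto (fun j => f (k j) t) atTop (𝓝 x) ∧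
      Tendsto (fun j => θk (k j) t) atTop (𝓝 (θ t))})
    (Aj : ℕ → ℝ → Set X)
    (hAj : ∀ j t, Aj j t = {x : X | ∃ k, j ≤ k ∧
      dist (f k t) x ≤ 1 / (j : ℝ) ∧ |θk k t - θ t| ≤ 1 / (j : ℝ)})
    (t : ℝ) (ht : t ∈ Set.Icc 0 T) (x : X) :
    infEdist x (A t) = ⨆ (j : ℕ) (_ : 1 ≤ j), infEdist x (Aj j t) := by
  refine le_antisymm ?_ (iSup₂_le fun j hj => Metric.infEDist_anti ?_)
  · by_contra! hlt
    obtain ⟨c, hc, hcA⟩ := exists_between hlt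
    have near (n : ℕ) : ∃ y ∈ Aj (n + 1) t, edist x y < c := by
      apply Metric.infEDist_lt_iff.1
      exact (le_iSup₂ (f := fun (j : ℕ) (_ : 1 ≤ j) => Metric.infEDist x (Aj j t))
        (n + 1) (Nat.le_add_left 1 n)).trans_lt hc
    choose y hy hyc using near
    simp only [hAj, Set.mem_ofPred_eq] at hy
    choose k hk hkf hkθ using hy
    obtain ⟨a, φ, hφ, ha⟩ := CompactSpace.tendsto_subseq y
    have hzero : Tendsto (fun n => 1 / ((φ n + 1 : ℕ) : ℝ)) atTop (𝓝 0) := by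
      simpa [Function.comp_def] using
        (tendsto_one_div_add_atTop_nhds_zero_nat (𝕜 := ℝ)).comp hφ.tendsto_atTop
    have haA : a ∈ A t := by
      rw [hA]
      refine ⟨k ∘ φ, tendsto_atTop_mono (fun n => (Nat.le_succ _).trans (hk (φ n)))
        hφ.tendsto_atTop, ?_, ?_⟩
      · refine (tendsto_iff_of_dist (squeeze_zero (fun _ => dist_nonneg) ?_ hzero)).2 ha
        exact fun n => hkf (φ n)
      · refine tendsto_iff_dist_tendsto_zero.2 (squeeze_zero (fun _ => dist_nonneg) ?_ hzero)
        exact fun n => hkθ (φ n)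
    have hac : edist x a ≤ c :=
      le_of_tendsto (tendsto_const_nhds.edist ha) (Eventually.of_forall fun n => (hyc (φ n)).le)
    exact absurd ((Metric.infEDist_le_edist_of_mem haA).trans hac) (not_le.2 hcA)
  · intro y hy
    rw [hA] at hy
    rw [hAj]
    obtain ⟨k, hk, hkf, hkθ⟩ := hy
    have hpos : (0 : ℝ) < 1 / (j : ℝ) := one_div_pos.2 (by exact_mod_cast hj)
    obtain ⟨n, hn, hnf, hnθ⟩ := ((hk.eventually_ge_atTop j).and
      ((hkf.eventually (Metric.closedBall_mem_nhds _ hpos)).and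
        (hkθ.eventually (Metric.closedBall_mem_nhds _ hpos)))).exists
    exact ⟨k n, hn, hnf, hnθ⟩
end

section
/- For every x ∈ X, the function t ↦ infEdist(x, A(t)) from [0,T] to [0, +∞] is Lebesgue measurable. -/
open Filter Topology MeasureTheory EMetric

/-- In a compact space, the distance from `x` to the set of cluster values of `u` along indices
for which `v` tends to `a` is a countable supremum of countable infima of distances. -/
lemma infEDist_setOf_tendsto_subseq {X Y : Type*} [PseudoMetricSpace X] [CompactSpace X]
    [PseudoMetricSpace Y] (u : ℕ → X) (v : ℕ → Y) (a : Y) (x : X) :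
    Metric.infEDist x {y : X | ∃ k : ℕ → ℕ, Tendsto k atTop atTop ∧
      Tendsto (fun j => u (k j)) atTop (𝓝 y) ∧ Tendsto (fun j => v (k j)) atTop (𝓝 a)} =
    ⨆ n : ℕ, ⨅ k : ℕ, edist x (u (n + k)) + n * edist (v (n + k)) a := by
  apply le_antisymm
  · refine le_of_forall_gt_imp_ge_of_dense fun r hr => ?_
    rcases eq_or_ne r ⊤ with rfl | hrtop
    · exact le_top
    have hex (n : ℕ) : ∃ k : ℕ, edist x (u (n + k)) + n * edist (v (n + k)) a < r :=
      iInf_lt_iff.1 ((le_iSup (fun n : ℕ => ⨅ k : ℕ,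
        edist x (u (n + k)) + n * edist (v (n + k)) a) n).trans_lt hr)
    choose k hk using hex
    obtain ⟨y, φ, hφ, hy⟩ := CompactSpace.tendsto_subseq fun n => u (n + k n)
    have hv : Tendsto (fun n => v (n + k n)) atTop (𝓝 a) := by
      rw [tendsto_iff_edist_tendsto_0]
      have hdiv : Tendsto (fun n : ℕ => r / (n : ENNReal)) atTop (𝓝 0) := by
        simpa using ENNReal.Tendsto.const_div ENNReal.tendsto_nat_nhds_top (Or.inr hrtop)
      refine tendsto_of_tendsto_of_tendsto_of_le_of_le tendsto_const_nhds hdiv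
        (fun _ => zero_le) fun n => ?_
      rw [ENNReal.le_div_iff_mul_le (Or.inr fun h => by simp [h] at hr)
        (Or.inl (ENNReal.natCast_ne_top n)), mul_comm]
      exact le_add_self.trans (hk n).le
    have hmem : Tendsto (fun j => φ j + k (φ j)) atTop atTop :=
      tendsto_atTop_mono (fun j => (hφ.id_le j).trans (Nat.le_add_right _ _)) tendsto_id
    refine le_trans (Metric.infEDist_le_edist_of_mem (y := y) ?_) ?_
    · exact ⟨fun j => φ j + k (φ j), hmem, hy, hv.comp hφ.tendsto_atTop⟩
    exact le_of_tendsto (tendsto_const_nhds.edist hy)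
      (Eventually.of_forall fun j => le_self_add.trans (hk (φ j)).le)
  · refine iSup_le fun n => Metric.le_infEDist.2 ?_
    rintro y ⟨k, hk, hu, hv⟩
    have hlim : Tendsto (fun j => edist x (u (k j)) + n * edist (v (k j)) a) atTop
        (𝓝 (edist x y)) := by
      simpa using (tendsto_const_nhds.edist hu).add (ENNReal.Tendsto.const_mul
        (tendsto_iff_edist_tendsto_0.1 hv) (Or.inr (ENNReal.natCast_ne_top n)))
    refine ge_of_tendsto hlim ?_
    filter_upwards [hk.eventually_ge_atTop n] with j hj
    obtain ⟨m, hm⟩ := Nat.exists_eq_add_of_le hj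
    rw [hm]
    exact iInf_le _ m

/-- With `f k` Borel measurable on `[0,T]` and `θk k, θ`
Lebesgue measurable on `[0,T]`, for every `x ∈ X` the function
`t ↦ infEdist x (A t)` from `[0,T]` to `[0,+∞]` is Lebesgue measurable. -/
theorem stmt5 {X : Type*} [MetricSpace X] [CompactSpace X]
    [MeasurableSpace X] [BorelSpace X]
    (T : ℝ) (hT : 0 < T)
    (f : ℕ → ℝ → X) (θk : ℕ → ℝ → ℝ) (θ : ℝ → ℝ)
    (hf : ∀ k, Measurable fun t : Set.Icc (0:ℝ) T => f k t)
    (hθk : ∀ k, NullMeasurable (θk k) (volume.restrict (Set.Icc (0:ℝ) T)))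
    (hθ : NullMeasurable θ (volume.restrict (Set.Icc (0:ℝ) T)))
    (A : ℝ → Set X)
    (hA : ∀ t, A t = {x : X | ∃ k : ℕ → ℕ, Tendsto k atTop atTop ∧
      Tendsto (fun j => f (k j) t) atTop (𝓝 x) ∧
      Tendsto (fun j => θk (k j) t) atTop (𝓝 (θ t))})
    (x : X) :
    NullMeasurable (fun t => infEdist x (A t))
      (volume.restrict (Set.Icc (0:ℝ) T)) := by
  have hdist (k : ℕ) : AEMeasurable (fun t => edist x (f k t))
      (volume.restrict (Set.Icc (0:ℝ) T)) :=
    (aemeasurable_restrict_iff_comap_subtype measurableSet_Icc).2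
      (measurable_edist_right.comp (hf k)).aemeasurable
  have hθ' := hθ.aemeasurable
  have hθk' (k : ℕ) := (hθk k).aemeasurable
  have heq : (fun t => Metric.infEDist x (A t)) = fun t => ⨆ n : ℕ, ⨅ k : ℕ,
      edist x (f (n + k) t) + n * edist (θk (n + k) t) (θ t) := by
    funext t
    rw [hA t]
    exact infEDist_setOf_tendsto_subseq (fun k => f k t) (fun k => θk k t) (θ t) x
  change NullMeasurable (fun t => Metric.infEDist x (A t)) _
  rw [heq]
  exact (AEMeasurable.iSup fun n => AEMeasurable.iInf fun k =>
    (hdist (n + k)).add (((hθk' (n + k)).edist hθ').const_mul _)).nullMeasurable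
end

section
/- There exists an at most countable set C ⊆ [0,T] such that for every t ∈ (0,T] \ C and every sequence (s_k) in [0,t) converging to t, one has μ(Γ(t) Δ ⋃_k Γ(s_k)) = 0, where Δ denotes the symmetric difference; moreover, for every t ∈ (0,T] (with no exceptional set) and every such sequence, μ((⋃_k Γ(s_k)) \ Γ(t)) = 0. -/
open Filter Topology MeasureTheory

/-- A countable union of earlier members of an a.e. increasing family is a.e. contained in a later
member. -/
theorem measure_iUnion_diff_eq_zero_of_ae_increasing {α : Type*} [MeasurableSpace α]
    {μ : Measure α} {T : ℝ} {Γ : ℝ → Set α}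
    (hmono : ∀ s t : ℝ, 0 ≤ s → s ≤ t → t ≤ T → μ (Γ s \ Γ t) = 0)
    {t : ℝ} (ht : t ≤ T) {s : ℕ → ℝ} (hs : ∀ k, s k ∈ Set.Ico 0 t) :
    μ ((⋃ k, Γ (s k)) \ Γ t) = 0 := by
  rw [Set.iUnion_sdiff, measure_iUnion_null_iff]
  exact fun k => hmono _ _ (hs k).1 (hs k).2.le ht

theorem measure_diff_of_measure_diff_eq_zero {α : Type*} [MeasurableSpace α] {μ : Measure α}
    {A B : Set α} (hA : MeasurableSet A) (hfin : μ A ≠ ⊤) (hAB : μ (A \ B) = 0) :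
    μ (B \ A) = μ B - μ A := by
  have hunion : μ (B ∪ A) = μ B := by
    rw [← Set.union_sdiff_self]
    exact measure_congr (union_ae_eq_left_of_ae_eq_empty (ae_eq_empty.2 hAB))
  rw [measure_sdiff' B hA.nullMeasurableSet hfin, hunion]

/-- The measure of an a.e. increasing family, extended constantly outside `[0, T]`, is monotone. -/
theorem monotone_measure_projIcc {α : Type*} [MeasurableSpace α] {μ : Measure α} {T : ℝ}
    (hT : 0 ≤ T) {Γ : ℝ → Set α}
    (hmono : ∀ s t : ℝ, 0 ≤ s → s ≤ t → t ≤ T → μ (Γ s \ Γ t) = 0) :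
    Monotone fun t => μ (Γ (Set.projIcc 0 T hT t)) := by
  intro s t hst
  exact measure_mono_ae (ae_le_set.2 (hmono _ _ (Set.projIcc 0 T hT s).2.1
    (Set.monotone_projIcc hT hst) (Set.projIcc 0 T hT t).2.2))

/-- At a continuity point `t` of the measure, `Γ t` is a.e. contained in the union of the members
along any sequence that converges to `t` from the left. -/
theorem measure_diff_iUnion_eq_zero_of_continuousAt {α : Type*} [MeasurableSpace α]
    {μ : Measure α} {T : ℝ} (hT : 0 ≤ T) {Γ : ℝ → Set α}
    (hmeas : ∀ t ∈ Set.Icc 0 T, MeasurableSet (Γ t))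
    (hfin : ∀ t ∈ Set.Icc 0 T, μ (Γ t) < ⊤)
    (hmono : ∀ s t : ℝ, 0 ≤ s → s ≤ t → t ≤ T → μ (Γ s \ Γ t) = 0)
    {t : ℝ} (ht : t ∈ Set.Ioc 0 T)
    (hcont : ContinuousAt (fun t => μ (Γ (Set.projIcc 0 T hT t))) t)
    {s : ℕ → ℝ} (hs : ∀ k, s k ∈ Set.Ico 0 t) (hlim : Tendsto s atTop (𝓝 t)) :
    μ (Γ t \ ⋃ k, Γ (s k)) = 0 := by
  have htI : t ∈ Set.Icc 0 T := ⟨ht.1.le, ht.2⟩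
  have hsI (k : ℕ) : s k ∈ Set.Icc 0 T := ⟨(hs k).1, (hs k).2.le.trans ht.2⟩
  have hlimμ : Tendsto (fun k => μ (Γ (s k))) atTop (𝓝 (μ (Γ t))) := by
    have h := hcont.tendsto.comp hlim
    simpa only [Function.comp_def, Set.projIcc_of_mem hT htI, Set.projIcc_of_mem hT (hsI _)]
      using h
  have hsub : Tendsto (fun k => μ (Γ t) - μ (Γ (s k))) atTop (𝓝 0) := by
    simpa only [tsub_self] using
      ENNReal.Tendsto.sub tendsto_const_nhds hlimμ (Or.inl (hfin t htI).ne)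
  refine le_antisymm (ge_of_tendsto' hsub fun k => ?_) zero_le
  rw [← measure_diff_of_measure_diff_eq_zero (hmeas _ (hsI k)) (hfin _ (hsI k)).ne
    (hmono _ _ (hs k).1 (hs k).2.le ht.2)]
  exact measure_mono (Set.sdiff_subset_sdiff_right (Set.subset_iUnion (fun k => Γ (s k)) k))

/-- There is an at most countable set `C ⊆ [0,T]` such that
for every `t ∈ (0,T] \ C` and every sequence `(s k)` in `[0,t)` converging to
`t` one has `μ (Γ t ∆ ⋃ k, Γ (s k)) = 0`; moreover for every `t ∈ (0,T]`
(with no exceptional set) and every such sequence,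
`μ ((⋃ k, Γ (s k)) \ Γ t) = 0`. -/
theorem stmt8 (n : ℕ) (hn : 1 ≤ n) (T : ℝ) (hT : 0 < T)
    (Γ : ℝ → Set (EuclideanSpace ℝ (Fin n)))
    (hmeas : ∀ t ∈ Set.Icc 0 T, MeasurableSet (Γ t))
    (hfin : ∀ t ∈ Set.Icc 0 T, μH[(n : ℝ) - 1] (Γ t) < ⊤)
    (hmono : ∀ s t : ℝ, 0 ≤ s → s ≤ t → t ≤ T → μH[(n : ℝ) - 1] (Γ s \ Γ t) = 0) :
    (∃ C : Set ℝ, C ⊆ Set.Icc 0 T ∧ C.Countable ∧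
      ∀ t ∈ Set.Ioc 0 T, t ∉ C → ∀ s : ℕ → ℝ,
        (∀ k, s k ∈ Set.Ico 0 t) → Tendsto s atTop (𝓝 t) →
        μH[(n : ℝ) - 1] (symmDiff (Γ t) (⋃ k, Γ (s k))) = 0) ∧
    (∀ t ∈ Set.Ioc 0 T, ∀ s : ℕ → ℝ,
      (∀ k, s k ∈ Set.Ico 0 t) → Tendsto s atTop (𝓝 t) →
      μH[(n : ℝ) - 1] ((⋃ k, Γ (s k)) \ Γ t) = 0) := by
  have hdiff : ∀ t ∈ Set.Ioc 0 T, ∀ s : ℕ → ℝ,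
      (∀ k, s k ∈ Set.Ico 0 t) → Tendsto s atTop (𝓝 t) →
      μH[(n : ℝ) - 1] ((⋃ k, Γ (s k)) \ Γ t) = 0 := fun _ ht _ hs _ =>
    measure_iUnion_diff_eq_zero_of_ae_increasing hmono ht.2 hs
  refine ⟨⟨Set.Icc 0 T ∩
    {t | ¬ ContinuousAt (fun t => μH[(n : ℝ) - 1] (Γ (Set.projIcc 0 T hT.le t))) t},
    Set.inter_subset_left,
    (monotone_measure_projIcc hT.le hmono).countable_not_continuousAt.mono Set.inter_subset_right,
    fun t ht htC s hs hlim => ?_⟩, hdiff⟩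
  have hcont := not_not.1 fun h => htC ⟨⟨ht.1.le, ht.2⟩, h⟩
  exact measure_union_null
    (measure_diff_iUnion_eq_zero_of_continuousAt hT.le hmeas hfin hmono ht hcont hs hlim)
    (hdiff t ht s hs hlim)
end

section
/- For every t ∈ [0,T) and any two sequences (s_k) and (s'_k) in (t,T] converging to t, the sets ⋂_k Γ(s_k) and ⋂_k Γ(s'_k) coincide up to μ-null sets, i.e. μ((⋂_k Γ(s_k)) Δ (⋂_k Γ(s'_k))) = 0; moreover, there exists an at most countable set C ⊆ [0,T) such that for every t ∈ [0,T) \ C and every sequence (s_k) in (t,T] converging to t, μ(Γ(t) Δ ⋂_k Γ(s_k)) = 0, where Δ denotes the symmetric difference. -/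
open Filter Topology MeasureTheory

/-- The family `Γ` is increasing on `[0, T]` up to `μ`-null sets. -/
def AEIncreasingOn {α : Type*} [MeasurableSpace α] (μ : Measure α) (T : ℝ) (Γ : ℝ → Set α) :
    Prop :=
  ∀ s t : ℝ, 0 ≤ s → s ≤ t → t ≤ T → μ (Γ s \ Γ t) = 0

namespace AEIncreasingOn

variable {α : Type*} [MeasurableSpace α] {μ : Measure α} {T : ℝ} {Γ : ℝ → Set α}

lemma measure_sdiff_iInter_eq_zero (h : AEIncreasingOn μ T Γ) {t : ℝ} (ht : t ∈ Set.Ico 0 T)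
    {s : ℕ → ℝ} (hs : ∀ k, s k ∈ Set.Ioc t T) : μ (Γ t \ ⋂ k, Γ (s k)) = 0 := by
  rw [Set.sdiff_iInter]
  exact measure_iUnion_null fun k => h _ _ ht.1 (hs k).1.le (hs k).2

lemma measure_iInter_sdiff_iInter_eq_zero (h : AEIncreasingOn μ T Γ) {t : ℝ}
    (ht : t ∈ Set.Ico 0 T) {s s' : ℕ → ℝ} (hs : ∀ k, s k ∈ Set.Ioc t T)
    (hs' : ∀ k, s' k ∈ Set.Ioc t T) (hlim : Tendsto s atTop (𝓝 t)) :
    μ ((⋂ k, Γ (s k)) \ ⋂ k, Γ (s' k)) = 0 := by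
  rw [Set.sdiff_iInter]
  refine measure_iUnion_null fun k => ?_
  obtain ⟨j, hj⟩ := (hlim.eventually_lt_const (hs' k).1).exists
  exact measure_mono_null (Set.sdiff_subset_sdiff_left (Set.iInter_subset _ j))
    (h _ _ (ht.1.trans (hs j).1.le) hj.le (hs' k).2)

lemma monotoneOn_measure (h : AEIncreasingOn μ T Γ) :
    MonotoneOn (fun t => μ (Γ t)) (Set.Icc 0 T) := fun s hs t ht hst =>
  measure_mono_ae (ae_le_set.2 (h s t hs.1 hst ht.2))

lemma measure_symmDiff_iInter_eq_zero (h : AEIncreasingOn μ T Γ) {t : ℝ}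
    (ht : t ∈ Set.Ico 0 T) (hmeas : NullMeasurableSet (Γ t) μ) (hfin : μ (Γ t) ≠ ⊤)
    (hcont : ContinuousWithinAt (fun t => μ (Γ t)) (Set.Icc 0 T) t)
    {s : ℕ → ℝ} (hs : ∀ k, s k ∈ Set.Ioc t T) (hlim : Tendsto s atTop (𝓝 t)) :
    μ (symmDiff (Γ t) (⋂ k, Γ (s k))) = 0 := by
  refine measure_union_null (h.measure_sdiff_iInter_eq_zero ht hs) ?_
  have hlim' : Tendsto (fun k => μ (Γ (s k))) atTop (𝓝 (μ (Γ t))) :=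
    hcont.tendsto.comp (tendsto_nhdsWithin_iff.2
      ⟨hlim, Eventually.of_forall fun k => ⟨ht.1.trans (hs k).1.le, (hs k).2⟩⟩)
  have hsub := ENNReal.Tendsto.sub hlim' (tendsto_const_nhds (x := μ (Γ t))) (Or.inl hfin)
  rw [tsub_self] at hsub
  refine le_antisymm (ge_of_tendsto' hsub fun k => ?_) zero_le
  refine (measure_mono (Set.sdiff_subset_sdiff_left (Set.iInter_subset _ k))).trans ?_
  refine ENNReal.le_sub_of_add_le_right hfin ?_
  have hsplit := measure_inter_add_sdiff₀ (Γ (s k)) hmeas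
  have hinter : μ (Γ (s k) ∩ Γ t) = μ (Γ t) := by
    refine measure_congr (ae_eq_set.2 ⟨?_, ?_⟩)
    · rw [Set.sdiff_eq_empty.2 Set.inter_subset_right, measure_empty]
    · rw [Set.sdiff_inter_self_eq_sdiff]
      exact h _ _ ht.1 (hs k).1.le (hs k).2
  rw [← hsplit, hinter, add_comm]

end AEIncreasingOn

/-- For every `t ∈ [0,T)` and any two sequences in `(t,T]`
converging to `t`, the intersections `⋂ k, Γ (s k)` and `⋂ k, Γ (s' k)`
coincide up to μ-null sets; moreover there is an at most countable set
`C ⊆ [0,T)` such that for every `t ∈ [0,T) \ C` and every such sequence,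
`μ (Γ t ∆ ⋂ k, Γ (s k)) = 0`. -/
theorem stmt9 (n : ℕ) (hn : 1 ≤ n) (T : ℝ) (hT : 0 < T)
    (Γ : ℝ → Set (EuclideanSpace ℝ (Fin n)))
    (hmeas : ∀ t ∈ Set.Icc 0 T, MeasurableSet (Γ t))
    (hfin : ∀ t ∈ Set.Icc 0 T, μH[(n : ℝ) - 1] (Γ t) < ⊤)
    (hmono : ∀ s t : ℝ, 0 ≤ s → s ≤ t → t ≤ T → μH[(n : ℝ) - 1] (Γ s \ Γ t) = 0) :
    (∀ t ∈ Set.Ico 0 T, ∀ s s' : ℕ → ℝ,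
      (∀ k, s k ∈ Set.Ioc t T) → (∀ k, s' k ∈ Set.Ioc t T) →
      Tendsto s atTop (𝓝 t) → Tendsto s' atTop (𝓝 t) →
      μH[(n : ℝ) - 1] (symmDiff (⋂ k, Γ (s k)) (⋂ k, Γ (s' k))) = 0) ∧
    (∃ C : Set ℝ, C ⊆ Set.Ico 0 T ∧ C.Countable ∧
      ∀ t ∈ Set.Ico 0 T, t ∉ C → ∀ s : ℕ → ℝ,
        (∀ k, s k ∈ Set.Ioc t T) → Tendsto s atTop (𝓝 t) →
        μH[(n : ℝ) - 1] (symmDiff (Γ t) (⋂ k, Γ (s k))) = 0) := by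
  have h : AEIncreasingOn μH[(n : ℝ) - 1] T Γ := hmono
  refine ⟨fun t ht s s' hs hs' hlim hlim' => measure_union_null
    (h.measure_iInter_sdiff_iInter_eq_zero ht hs hs' hlim)
    (h.measure_iInter_sdiff_iInter_eq_zero ht hs' hs hlim'), ?_⟩
  refine ⟨{t | t ∈ Set.Ico 0 T ∧
    ¬ContinuousWithinAt (fun t => μH[(n : ℝ) - 1] (Γ t)) (Set.Icc 0 T) t}, fun t ht => ht.1,
    h.monotoneOn_measure.countable_not_continuousWithinAt.mono ?_, ?_⟩
  · rintro t ⟨ht, hc⟩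
    exact ⟨Set.Ico_subset_Icc_self ht, hc⟩
  intro t ht htC s hs hlim
  have ht' := Set.Ico_subset_Icc_self ht
  exact h.measure_symmDiff_iInter_eq_zero ht (hmeas t ht').nullMeasurableSet (hfin t ht').ne
    (not_not.1 fun hc => htC ⟨ht, hc⟩) hs hlim
end
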